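/- Let G and G' be finite groups, n ≥ 1, and let H : Fin (n+1) → Subgroup G and H' : Fin (n+1) → Subgroup G' be monotone families of subgroups with H 0 = ⊥ = H' 0, H n = ⊤, H' n = ⊤, and |H i| = |H' i| for every i. Then there exists a bijection η : G → G' such that d_{C'}(η(x), η(y)) = d_C(x, y) for all x, y ∈ G, where d_C and d_{C'} are the chain distances of the two chains; i.e. the two chains are isometric. -/

import Mathlib

/-- The chain weight of `x` with respect to a chain of subgroups
`H : Fin (n+1) → Subgroup G`: the least index `i` with `x ∈ H i`. -/
noncomputable def chainWeight {G : Type*} [Group G] {n : ℕ}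
    (H : Fin (n + 1) → Subgroup G) (x : G) : ℕ :=
  sInf {i : ℕ | ∃ hi : i < n + 1, x ∈ H ⟨i, hi⟩}

/-- The chain distance associated to a chain of subgroups:
`d_C(x, y) = w_C(x * y⁻¹)`. -/
noncomputable def chainDist {G : Type*} [Group G] {n : ℕ}
    (H : Fin (n + 1) → Subgroup G) (x y : G) : ℕ :=
  chainWeight H (x * y⁻¹)

/-- For `x = k * t` with `k` in the subgroup and `t` in a right transversal, two elements lie in
the same right coset of the subgroup exactly when their transversal parts agree. -/
theorem Subgroup.IsComplement.mul_inv_mem_iff {G : Type*} [Group G] {K : Subgroup G} {T : Set G}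
    (hT : Subgroup.IsComplement (K : Set G) T) (x y : G) :
    x * y⁻¹ ∈ K ↔ (hT.equiv x).2 = (hT.equiv y).2 := by
  rw [eq_comm, hT.equiv_snd_eq_iff_rightCosetEquivalence, RightCosetEquivalence,
    rightCoset_eq_iff]

theorem Subgroup.IsComplement.mul_inv_eq_of_snd_eq {G : Type*} [Group G] {S T : Set G}
    (hT : Subgroup.IsComplement S T) {x y : G}
    (h : (hT.equiv x).2 = (hT.equiv y).2) :
    x * y⁻¹ = (hT.equiv x).1 * ((hT.equiv y).1 : G)⁻¹ := by
  rw [hT.equiv_fst_eq_mul_inv x, hT.equiv_fst_eq_mul_inv y, h]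
  group

/-- A bijection between subgroups of finite groups of equal order extends, coset by coset, to a
bijection of the groups. -/
theorem exists_equiv_extending_cosetwise {G G' : Type*} [Group G] [Finite G] [Group G'] [Finite G']
    {K : Subgroup G} {K' : Subgroup G'} (e : K ≃ K') (hcard : Nat.card G = Nat.card G') :
    ∃ f : G ≃ G', (∀ x y, f x * (f y)⁻¹ ∈ K' ↔ x * y⁻¹ ∈ K) ∧
      ∀ x y, x * y⁻¹ ∈ K → ∃ k l : K, x * y⁻¹ = k * (l : G)⁻¹ ∧
        f x * (f y)⁻¹ = e k * (e l : G')⁻¹ := by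
  obtain ⟨T, hT, -⟩ := K.exists_isComplement_right 1
  obtain ⟨T', hT', -⟩ := K'.exists_isComplement_right 1
  have hTT' : Nat.card T = Nat.card T' := by
    have h := hT.card_mul_card
    rw [hcard, ← hT'.card_mul_card] at h
    have hK : Nat.card (K : Set G) = Nat.card (K' : Set G') := Nat.card_congr e
    rw [hK] at h
    exact Nat.eq_of_mul_eq_mul_left (Nat.card_pos (α := K')) h
  let t : T ≃ T' := (Finite.card_eq.mp hTT').some
  let f : G ≃ G' := hT.equiv.trans ((Equiv.prodCongr e t).trans hT'.equiv.symm)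
  have hf (x : G) : hT'.equiv (f x) = (e (hT.equiv x).1, t (hT.equiv x).2) :=
    hT'.equiv.apply_symm_apply _
  refine ⟨f, fun x y ↦ ?_, fun x y hxy ↦ ⟨(hT.equiv x).1, (hT.equiv y).1, ?_, ?_⟩⟩
  · rw [hT.mul_inv_mem_iff, hT'.mul_inv_mem_iff, hf, hf]
    exact t.apply_eq_iff_eq
  · exact hT.mul_inv_eq_of_snd_eq ((hT.mul_inv_mem_iff x y).mp hxy)
  · rw [hT'.mul_inv_eq_of_snd_eq, hf, hf]
    rw [hf, hf, (hT.mul_inv_mem_iff x y).mp hxy]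

/-- Chains of subgroups with termwise equal orders admit, at each level, a bijection respecting
membership of `x * y⁻¹` in all lower levels. -/
theorem exists_equiv_level {G G' : Type*} [Group G] [Finite G] [Group G'] [Finite G'] {n : ℕ}
    {H : Fin (n + 1) → Subgroup G} {H' : Fin (n + 1) → Subgroup G'}
    (hmono : Monotone H) (hmono' : Monotone H')
    (hcard : ∀ i, Nat.card (H i) = Nat.card (H' i)) (i : Fin (n + 1)) :
    ∃ e : H i ≃ H' i, ∀ j ≤ i, ∀ x y : H i,
      (e x : G') * (e y : G')⁻¹ ∈ H' j ↔ (x : G) * (y : G)⁻¹ ∈ H j := by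
  have top_level (i : Fin (n + 1)) (e : H i ≃ H' i) (x y : H i) :
      (e x : G') * (e y : G')⁻¹ ∈ H' i ↔ (x : G) * (y : G)⁻¹ ∈ H i :=
    iff_of_true (mul_mem (e x).2 (inv_mem (e y).2)) (mul_mem x.2 (inv_mem y.2))
  induction i using Fin.induction with
  | zero =>
    refine ⟨(Finite.card_eq.mp (hcard 0)).some, fun j hj x y ↦ ?_⟩
    obtain rfl : j = 0 := Fin.le_zero_iff.mp hj
    exact top_level ..
  | succ i ih =>
    obtain ⟨e, he⟩ := ih
    have hle := hmono (Fin.castSucc_le_succ i)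
    have hle' := hmono' (Fin.castSucc_le_succ i)
    obtain ⟨f, hf, hfe⟩ := exists_equiv_extending_cosetwise
      ((Subgroup.subgroupOfEquivOfLe hle).toEquiv.trans
        (e.trans (Subgroup.subgroupOfEquivOfLe hle').toEquiv.symm)) (hcard i.succ)
    refine ⟨f, fun j hj x y ↦ ?_⟩
    obtain rfl | hj := hj.eq_or_lt
    · exact top_level ..
    have hj : j ≤ i.castSucc := Fin.le_castSucc_iff.mpr hj
    by_cases hxy : x * y⁻¹ ∈ (H i.castSucc).subgroupOf (H i.succ)
    · obtain ⟨k, l, hkl, hkl'⟩ := hfe x y hxy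
      have h := congrArg (Subtype.val) hkl
      have h' := congrArg (Subtype.val) hkl'
      have key := he j hj (Subgroup.subgroupOfEquivOfLe hle k) (Subgroup.subgroupOfEquivOfLe hle l)
      simp only [Subgroup.coe_mul, Subgroup.coe_inv] at h h'
      rw [h, h']
      exact key
    · exact iff_of_false (fun h ↦ hxy ((hf x y).mp (hmono' hj h))) (fun h ↦ hxy (hmono hj h))

/-- Two chains of subgroups of the same length in finite groups
`G`, `G'`, with termwise equal orders, are isometric: there is a bijection
`η : G → G'` carrying the chain distance of one chain to that of the other. -/
theorem stmt_16 {G G' : Type*} [Group G] [Fintype G] [Group G'] [Fintype G']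
    (n : ℕ) (hn : 1 ≤ n)
    (H : Fin (n + 1) → Subgroup G) (H' : Fin (n + 1) → Subgroup G')
    (hmono : Monotone H) (hmono' : Monotone H')
    (hbot : H 0 = ⊥) (hbot' : H' 0 = ⊥)
    (htop : H (Fin.last n) = ⊤) (htop' : H' (Fin.last n) = ⊤)
    (hcard : ∀ i : Fin (n + 1), Nat.card (H i) = Nat.card (H' i)) :
    ∃ η : G ≃ G', ∀ x y : G, chainDist H' (η x) (η y) = chainDist H x y := by
  obtain ⟨e, he⟩ := exists_equiv_level hmono hmono' hcard (Fin.last n)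
  let a : G ≃ H (Fin.last n) := (Equiv.subtypeUnivEquiv fun x ↦ htop ▸ Subgroup.mem_top x).symm
  let b : H' (Fin.last n) ≃ G' := Equiv.subtypeUnivEquiv fun x ↦ htop' ▸ Subgroup.mem_top x
  refine ⟨a.trans (e.trans b), fun x y ↦ ?_⟩
  unfold chainDist chainWeight
  congr 1
  ext i
  exact exists_congr fun hi ↦ he ⟨i, hi⟩ (Fin.le_last _) (a x) (a y)
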